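/- Let G be a group, F the standard resolution, and τ: F ⊗ F → F ⊗ F the chain map x ⊗ y ↦ (-1)^{deg x · deg y} y ⊗ x. Define φ: (F ⊗ F)_n → (F ⊗ F)_{n+1} on basis elements (s_0,…,s_p) ⊗ y with y ∈ G^{q+1} by φ((s_0,…,s_p) ⊗ y) = (-1)^{pq} Σ_{i=0}^p (-1)^{(q+1)i} (s_0,…,s_i,y) ⊗ (s_i,…,s_p) − (-1)^p Σ_{i=0}^p (s_0,…,s_i) ⊗ (s_i,…,s_p,y). Then φ is a chain homotopy from τ to the identity: τ − id = ∂φ + φ∂. -/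

import Mathlib

noncomputable section

open Finsupp TensorProduct

/-- Tuples of length `n+1` in `G`: the basis of degree-`n` part of the bar resolution. -/
abbrev Tup (G : Type) (n : ℕ) := Fin (n + 1) → G

/-- The total module of the standard (bar) resolution: free `ℤ`-module on all tuples. -/
abbrev Bar (G : Type) : Type := (Σ n : ℕ, Tup G n) →₀ ℤ

/-- The total module of the tensor square of the bar resolution:
free `ℤ`-module on pairs of tuples. -/
abbrev Bar2 (G : Type) : Type := (Σ (p : ℕ) (q : ℕ), Tup G p × Tup G q) →₀ ℤ

variable (G : Type) [Group G]

/-- Basis element of `Bar G` in degree `n`. -/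
def bb (n : ℕ) (s : Tup G n) : Bar G := Finsupp.single ⟨n, s⟩ 1

/-- Basis element of `Bar2 G` in bidegree `(p, q)`. -/
def cc (p q : ℕ) (x : Tup G p) (y : Tup G q) : Bar2 G := Finsupp.single ⟨p, q, (x, y)⟩ 1

/-- The `i`-th face: delete the `i`-th entry of a tuple. -/
def face {n : ℕ} (i : Fin (n + 2)) (s : Tup G (n + 1)) : Tup G n := fun j => s (i.succAbove j)

/-- The simplicial boundary `∂(s₀,…,sₙ) = Σ (-1)ⁱ (s₀,…,ŝᵢ,…,sₙ)` on the bar resolution. -/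
def bnd : Bar G →ₗ[ℤ] Bar G :=
  Finsupp.lift (Bar G) ℤ _ fun w =>
    match w with
    | ⟨0, _⟩ => 0
    | ⟨n + 1, s⟩ => ∑ i : Fin (n + 2), ((-1 : ℤ) ^ (i : ℕ)) • bb G n (face G i s)

/-- The augmentation `ε : F₀ → ℤ` (extended by zero to the total module). -/
def aug : Bar G →ₗ[ℤ] ℤ := Finsupp.lift ℤ ℤ _ fun w => if w.1 = 0 then 1 else 0

/-- The diagonal action of `u ∈ G` on the bar resolution. -/
def act (u : G) : Bar G →ₗ[ℤ] Bar G :=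
  Finsupp.lift (Bar G) ℤ _ fun w => bb G w.1 fun j => u * w.2 j

/-- Right translation `τₛ(s₀,…,sₙ) = (s₀s,…,sₙs)`. -/
def tau (s : G) : Bar G →ₗ[ℤ] Bar G :=
  Finsupp.lift (Bar G) ℤ _ fun w => bb G w.1 fun j => w.2 j * s

/-- The contracting homotopy `ψₜ(s₀,…,sₙ) = (t,s₀,…,sₙ)`. -/
def psi (t : G) : Bar G →ₗ[ℤ] Bar G :=
  Finsupp.lift (Bar G) ℤ _ fun w => bb G (w.1 + 1) (Fin.cons t w.2)

/-- The degree `-1` part of the contracting homotopy: `ψₜ(1) = (t) ∈ F₀`. -/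
def psiNeg (t : G) : ℤ →ₗ[ℤ] Bar G := LinearMap.toSpanSingleton ℤ (Bar G) (bb G 0 fun _ => t)

/-- The degenerate subcomplex `D ⊆ F`, spanned by tuples with two equal consecutive entries. -/
def degen : Submodule ℤ (Bar G) :=
  Submodule.span ℤ
    {z | ∃ (n : ℕ) (s : Tup G n) (i : Fin n), s i.castSucc = s i.succ ∧ z = bb G n s}

/-- The tuple `(s₀,…,sᵢ,sᵢs,…,sₙs)` obtained from `(s₀,…,sₙ)`. -/
def ins (s : G) (n : ℕ) (x : Tup G n) (i : Fin (n + 1)) : Tup G (n + 1) := fun j =>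
  if _h : (j : ℕ) ≤ (i : ℕ) then x ⟨(j : ℕ), by have := i.isLt; omega⟩
  else x ⟨(j : ℕ) - 1, by have := j.isLt; omega⟩ * s

/-- The homotopy `φₛ(s₀,…,sₙ) = Σ (-1)ⁱ (s₀,…,sᵢ,sᵢs,…,sₙs)` from `τₛ` to the identity. -/
def phi (s : G) : Bar G →ₗ[ℤ] Bar G :=
  Finsupp.lift (Bar G) ℤ _ fun w =>
    ∑ i : Fin (w.1 + 1), ((-1 : ℤ) ^ (i : ℕ)) • bb G (w.1 + 1) (ins G s w.1 w.2 i)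

/-- The boundary on `F ⊗ F`: `∂(x⊗y) = ∂x⊗y + (-1)^{deg x} x⊗∂y`. -/
def bnd2 : Bar2 G →ₗ[ℤ] Bar2 G :=
  Finsupp.lift (Bar2 G) ℤ _ fun w =>
    (match w with
     | ⟨0, _, _, _⟩ => 0
     | ⟨p + 1, q, x, y⟩ => ∑ i : Fin (p + 2), ((-1 : ℤ) ^ (i : ℕ)) • cc G p q (face G i x) y)
    + (match w with
       | ⟨_, 0, _, _⟩ => 0
       | ⟨p, q + 1, x, y⟩ =>
           ((-1 : ℤ) ^ p) • ∑ i : Fin (q + 2), ((-1 : ℤ) ^ (i : ℕ)) • cc G p q x (face G i y))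

/-- The augmentation `ε ⊗ ε` on `F ⊗ F` (extended by zero to the total module). -/
def aug2 : Bar2 G →ₗ[ℤ] ℤ :=
  Finsupp.lift ℤ ℤ _ fun w => if w.1 = 0 ∧ w.2.1 = 0 then 1 else 0

/-- The diagonal action of `u ∈ G` on `F ⊗ F`. -/
def act2 (u : G) : Bar2 G →ₗ[ℤ] Bar2 G :=
  Finsupp.lift (Bar2 G) ℤ _ fun w =>
    cc G w.1 w.2.1 (fun j => u * w.2.2.1 j) (fun j => u * w.2.2.2 j)

/-- The twist `τ(x⊗y) = (-1)^{deg x · deg y} y⊗x` on `F ⊗ F`. -/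
def tau2 : Bar2 G →ₗ[ℤ] Bar2 G :=
  Finsupp.lift (Bar2 G) ℤ _ fun w =>
    ((-1 : ℤ) ^ (w.1 * w.2.1)) • cc G w.2.1 w.1 w.2.2.2 w.2.2.1

/-- The contracting homotopy `ψ_{s,t}` of `F ⊗ F → ℤ → 0`. -/
def psi2 (s t : G) : Bar2 G →ₗ[ℤ] Bar2 G :=
  Finsupp.lift (Bar2 G) ℤ _ fun w =>
    match w with
    | ⟨0, q, x, y⟩ =>
        cc G 1 q (Fin.cons s x) y + cc G 0 (q + 1) (fun _ => s) (Fin.cons t y)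
    | ⟨p + 1, q, x, y⟩ => cc G (p + 2) q (Fin.cons s x) y

/-- The degree `-1` part of `ψ_{s,t}`: `1 ↦ s ⊗ t`. -/
def psi2Neg (s t : G) : ℤ →ₗ[ℤ] Bar2 G :=
  LinearMap.toSpanSingleton ℤ (Bar2 G) (cc G 0 0 (fun _ => s) (fun _ => t))

/-- The homotopy `φ` from the twist `τ` to the identity on `F ⊗ F`:
`φ((s₀,…,s_p) ⊗ y) = (-1)^{pq} Σᵢ (-1)^{(q+1)i} (s₀,…,sᵢ,y) ⊗ (sᵢ,…,s_p)
  − (-1)^p Σᵢ (s₀,…,sᵢ) ⊗ (sᵢ,…,s_p,y)`. -/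
def phi2 : Bar2 G →ₗ[ℤ] Bar2 G :=
  Finsupp.lift (Bar2 G) ℤ _ fun w =>
    match w with
    | ⟨p, q, x, y⟩ =>
      ((-1 : ℤ) ^ (p * q)) •
          (∑ i : Fin (p + 1), ((-1 : ℤ) ^ ((q + 1) * (i : ℕ))) •
            cc G ((i : ℕ) + q + 1) (p - (i : ℕ))
              (fun j =>
                if _h : (j : ℕ) ≤ (i : ℕ) then x ⟨(j : ℕ), by have := i.isLt; omega⟩
                else y ⟨(j : ℕ) - ((i : ℕ) + 1), by have := j.isLt; omega⟩)
              (fun j => x ⟨(i : ℕ) + (j : ℕ), by have := j.isLt; have := i.isLt; omega⟩))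
        - ((-1 : ℤ) ^ p) •
          (∑ i : Fin (p + 1),
            cc G (i : ℕ) (p - (i : ℕ) + q + 1)
              (fun j => x ⟨(j : ℕ), by have := j.isLt; have := i.isLt; omega⟩)
              (fun j =>
                if _h : (j : ℕ) ≤ p - (i : ℕ) then
                  x ⟨(i : ℕ) + (j : ℕ), by have := i.isLt; omega⟩
                else y ⟨(j : ℕ) - (p - (i : ℕ) + 1), by have := j.isLt; omega⟩))

namespace S11

set_option linter.unusedSimpArgs false

abbrev T (H : Type) := List H →₀ ℤ

abbrev TT (H : Type) := (List H × List H) →₀ ℤ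

def e {H : Type} (x : List H) : T H := Finsupp.single x 1

def lft {H N : Type} [AddCommGroup N] (f : List H → N) : T H →ₗ[ℤ] N := Finsupp.lift N ℤ _ f

@[simp] theorem lft_e {H N : Type} [AddCommGroup N] (f : List H → N) (x : List H) :
    lft f (e x) = f x := by
  simp [lft, e]

theorem hext {H N : Type} [AddCommGroup N] {f g : T H →ₗ[ℤ] N} (h : ∀ x, f (e x) = g (e x)) :
    f = g := by
  apply Finsupp.lhom_ext'
  intro x
  apply LinearMap.ext_ring
  exact h x

def lft2 {H N : Type} [AddCommGroup N] (f : List H → List H → N) : TT H →ₗ[ℤ] N :=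
  Finsupp.lift N ℤ _ fun w => f w.1 w.2

def tm {H : Type} : T H →ₗ[ℤ] T H →ₗ[ℤ] TT H :=
  lft fun x => lft fun y => Finsupp.single (x, y) 1

theorem tm_e {H : Type} (x y : List H) : tm (e x) (e y) = Finsupp.single (x, y) 1 := by simp [tm]

@[simp] theorem lft2_e {H N : Type} [AddCommGroup N] (f : List H → List H → N) (x y : List H) :
    lft2 f (tm (e x) (e y)) = f x y := by
  simp [lft2, tm_e]

theorem hext2 {H N : Type} [AddCommGroup N] {f g : TT H →ₗ[ℤ] N}
    (h : ∀ x y, f (tm (e x) (e y)) = g (tm (e x) (e y))) : f = g := by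
  apply Finsupp.lhom_ext'
  rintro ⟨x, y⟩
  apply LinearMap.ext_ring
  simpa [tm_e] using h x y

def tmap {H : Type} (f g : T H →ₗ[ℤ] T H) : TT H →ₗ[ℤ] TT H :=
  lft2 fun x y => tm (f (e x)) (g (e y))

@[simp] theorem tmap_t {H : Type} (f g : T H →ₗ[ℤ] T H) (x y : T H) :
    tmap f g (tm x y) = tm (f x) (g y) := by
  have : (LinearMap.llcomp ℤ _ _ _ (tmap f g)) ∘ₗ tm = (LinearMap.lcomp ℤ _ g) ∘ₗ tm ∘ₗ f := by
    apply hext; intro x; apply hext; intro y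
    simp [tmap]
  exact LinearMap.congr_fun (LinearMap.congr_fun this x) y

/-- left concatenation with a letter -/
def L {H : Type} (s : H) : T H →ₗ[ℤ] T H := lft fun x => e (s :: x)

@[simp] theorem L_e {H : Type} (s : H) (x : List H) : L s (e x) = e (s :: x) := by simp [L]

def L2 {H : Type} (s : H) : TT H →ₗ[ℤ] TT H := tmap (L s) LinearMap.id

@[simp] theorem L2_t {H : Type} (s : H) (x y : T H) : L2 s (tm x y) = tm (L s x) y := by simp [L2]

def sgn {H : Type} : T H →ₗ[ℤ] T H := lft fun x => ((-1 : ℤ) ^ x.length) • e x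

@[simp] theorem sgn_e {H : Type} (x : List H) :
    sgn (e x) = ((-1 : ℤ) ^ x.length) • e x := by simp [sgn]

theorem sgn_L {H : Type} (s : H) (z : T H) : sgn (L s z) = - L s (sgn z) := by
  have : sgn ∘ₗ L s = - (L s ∘ₗ sgn) := by
    apply hext; intro x; simp [pow_succ]
  exact LinearMap.congr_fun this z

def dl {H : Type} : List H → T H
  | [] => 0
  | s :: x => e x - L s (dl x)

def d {H : Type} : T H →ₗ[ℤ] T H := lft dl

@[simp] theorem d_nil {H : Type} : d (e ([] : List H)) = 0 := by simp [d, dl]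

theorem d_cons {H : Type} (s : H) (x : List H) : d (e (s :: x)) = e x - L s (d (e x)) := by
  simp [d, dl]

theorem d_L {H : Type} (s : H) (z : T H) : d (L s z) = z - L s (d z) := by
  have : d ∘ₗ L s = LinearMap.id - (L s ∘ₗ d) := by
    apply hext; intro x; simp [d_cons]
  exact LinearMap.congr_fun this z

theorem sgn_d {H : Type} (x : List H) :
    sgn (d (e x)) = - (((-1 : ℤ) ^ x.length) • d (e x)) := by
  induction x with
  | nil => simp
  | cons s x ih => 
    rw [d_cons, map_sub, sgn_L, ih]
    simp only [sgn_e, List.length_cons, pow_succ, map_neg, map_smul]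
    module

def D {H : Type} : TT H →ₗ[ℤ] TT H :=
  tmap d LinearMap.id - tmap sgn d

theorem D_t {H : Type} (x y : T H) : D (tm x y) = tm (d x) y - tm (sgn x) (d y) := by simp [D]

theorem D_L2 {H : Type} (s : H) (z : TT H) : D (L2 s z) = z - L2 s (D z) := by
  have : D ∘ₗ L2 s = LinearMap.id - (L2 s ∘ₗ D) := by
    apply hext2
    intro x y
    simp only [LinearMap.comp_apply, LinearMap.sub_apply, LinearMap.id_apply, L2_t, D_t, d_L,
      sgn_L, map_sub, LinearMap.sub_apply, map_neg, LinearMap.neg_apply]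
    abel
  exact LinearMap.congr_fun this z

/-- `conc x z = x ++ z`, bilinear. -/
def cl {H : Type} : List H → (T H →ₗ[ℤ] T H)
  | [] => LinearMap.id
  | s :: x => L s ∘ₗ cl x

def conc {H : Type} : T H →ₗ[ℤ] T H →ₗ[ℤ] T H := lft cl

theorem conc_nil {H : Type} (z : T H) : conc (e []) z = z := by simp [conc, cl]

theorem conc_L {H : Type} (s : H) (x z : T H) : conc (L s x) z = L s (conc x z) := by
  have : conc ∘ₗ L s = (LinearMap.llcomp ℤ _ _ _ (L s)) ∘ₗ conc := by
    apply hext; intro x; simp [conc, cl]; rfl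
  exact LinearMap.congr_fun (LinearMap.congr_fun this x) z

theorem conc_cons {H : Type} (s : H) (x : List H) (z : T H) :
    conc (e (s :: x)) z = L s (conc (e x) z) := by
  rw [← L_e, conc_L]

theorem conc_e {H : Type} (x y : List H) : conc (e x) (e y) = e (x ++ y) := by
  induction x with
  | nil => simp [conc_nil]
  | cons s x ih => simp [conc_cons, ih]

theorem d_conc {H : Type} (x : List H) (z : T H) :
    d (conc (e x) z) = conc (d (e x)) z + ((-1 : ℤ) ^ x.length) • conc (e x) (d z) := by
  induction x with
  | nil => simp [conc_nil]
  | cons s x ih =>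
    rw [conc_cons, d_L, ih, d_cons, conc_cons]
    simp only [map_sub, LinearMap.sub_apply, conc_L, List.length_cons, pow_succ, map_add, map_smul]
    module

/-- first half of the homotopy -/
def al {H : Type} : List H → (T H →ₗ[ℤ] TT H)
  | [] => 0
  | s :: x => (tm).flip (e (s :: x)) ∘ₗ L s + L2 s ∘ₗ al x ∘ₗ sgn

def A {H : Type} : T H →ₗ[ℤ] T H →ₗ[ℤ] TT H := lft al

theorem A_nil {H : Type} (z : T H) : A (e []) z = 0 := by simp [A, al]

theorem A_L {H : Type} (s : H) (x z : T H) :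
    A (L s x) z = tm (L s z) (L s x) + L2 s (A x (sgn z)) := by
  have : A ∘ₗ L s = (LinearMap.lcomp ℤ _ (L s)) ∘ₗ (tm).flip ∘ₗ L s
     + (LinearMap.llcomp ℤ _ _ _ (L2 s)) ∘ₗ (LinearMap.lcomp ℤ _ sgn) ∘ₗ A := by
    apply hext; intro x; simp [A, al]; rfl
  exact LinearMap.congr_fun (LinearMap.congr_fun this x) z

theorem A_cons {H : Type} (s : H) (x : List H) (z : T H) :
    A (e (s :: x)) z = tm (L s z) (e (s :: x)) + L2 s (A (e x) (sgn z)) := by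
  rw [← L_e, A_L]

def bl {H : Type} : List H → (T H →ₗ[ℤ] TT H)
  | [] => 0
  | s :: x => (tm) (e [s]) ∘ₗ conc (e (s :: x)) + L2 s ∘ₗ bl x

def B {H : Type} : T H →ₗ[ℤ] T H →ₗ[ℤ] TT H := lft bl

theorem B_nil {H : Type} (z : T H) : B (e []) z = 0 := by simp [B, bl]

theorem B_L {H : Type} (s : H) (x z : T H) :
    B (L s x) z = tm (e [s]) (L s (conc x z)) + L2 s (B x z) := by
  have : B ∘ₗ L s = (LinearMap.llcomp ℤ _ _ _ ((tm) (e [s]) ∘ₗ L s))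
      ∘ₗ conc + (LinearMap.llcomp ℤ _ _ _ (L2 s)) ∘ₗ B := by
    apply hext; intro x; apply LinearMap.ext; intro z; simp [B, bl, conc_cons]
  exact LinearMap.congr_fun (LinearMap.congr_fun this x) z

theorem B_cons {H : Type} (s : H) (x : List H) (z : T H) :
    B (e (s :: x)) z = tm (e [s]) (L s (conc (e x) z)) + L2 s (B (e x) z) := by
  rw [← L_e, B_L]

theorem D_A {H : Type} (x y : List H) :
    D (A (e x) (e y)) = ((-1 : ℤ) ^ y.length) • A (d (e x)) (e y) - A (e x) (d (e y)) + tm (e y) (e x)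
      - ((-1 : ℤ) ^ (x.length * (y.length + 1))) • (tm (e (x ++ y)) (e [])) := by
  induction x with
  | nil => simp [A_nil]
  | cons s x ih =>
    have h1 : (-1 : ℤ) ^ ((s :: x).length * (y.length + 1)) =
        - ((-1 : ℤ) ^ (x.length * (y.length + 1)) * (-1) ^ y.length) := by
      rw [List.length_cons, add_mul, pow_add]; ring
    have h2 : ((-1 : ℤ) ^ y.length) * (-1) ^ y.length = 1 := by
      rw [← mul_pow]; simp
    rw [A_cons, map_add, D_t, D_L2, sgn_L, d_L, d_cons, A_cons, sgn_d, h1]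
    simp only [sgn_e, map_smul, map_neg, map_sub, map_add, LinearMap.sub_apply, A_L, ih, L2_t, L_e,
      LinearMap.sub_apply, map_sub, LinearMap.neg_apply,
      LinearMap.smul_apply, List.cons_append]
    generalize (-1 : ℤ) ^ y.length = b at *
    generalize (-1 : ℤ) ^ (x.length * (y.length + 1)) = a at *
    have h3 : ∀ z : TT H, b • b • z = z := fun z => by rw [smul_smul, h2, one_smul]
    simp only [smul_add, smul_sub, smul_smul]
    match_scalars <;> grind

theorem D_B {H : Type} (x y : List H) :
    D (B (e x) (e y)) = B (d (e x)) (e y) + ((-1 : ℤ) ^ x.length) • B (e x) (d (e y))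
      - ((-1 : ℤ) ^ x.length) • (tm (e x) (e y)) + tm (e []) (e (x ++ y)) := by
  induction x with
  | nil => simp [B_nil]
  | cons s x ih =>
    rw [B_cons, map_add, D_t, D_L2, d_L, d_cons, B_cons, d_conc, d_cons, d_nil, ih]
    simp only [sgn_e, map_smul, map_neg, map_sub, map_add, LinearMap.sub_apply, B_L, ih, L2_t, L_e,
      LinearMap.sub_apply, map_sub, LinearMap.neg_apply,
      map_sub, map_sub, map_zero, conc_e,
      LinearMap.smul_apply, List.cons_append, List.length_cons, pow_succ, List.length_nil,
      LinearMap.zero_apply]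
    module

theorem A_eq_B {H : Type} (x : List H) : A (e x) (e []) = B (e x) (e []) := by
  induction x with
  | nil => simp [A_nil, B_nil]
  | cons s x ih => simp [A_cons, B_cons, ih, conc_e]

/-- the full homotopy -/
def Ph {H : Type} : TT H →ₗ[ℤ] TT H :=
  (lft2 fun x y =>
    ((-1 : ℤ) ^ x.length) • B (e x) (e y)
      - ((-1 : ℤ) ^ (x.length * y.length + x.length + y.length)) • A (e x) (e y))

theorem Ph_e {H : Type} (x y : List H) : Ph (tm (e x) (e y)) =
    ((-1 : ℤ) ^ x.length) • B (e x) (e y)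
      - ((-1 : ℤ) ^ (x.length * y.length + x.length + y.length)) • A (e x) (e y) := by
  simp [Ph]

/-- span of words of given length -/
def W (H : Type) (n : ℕ) : Submodule ℤ (T H) := Submodule.span ℤ {z | ∃ x : List H, x.length + 1 = n ∧ z = e x}

theorem d_mem {H : Type} (x : List H) : d (e x) ∈ W H x.length := by
  induction x with
  | nil => simp
  | cons s x ih =>
    rw [d_cons]
    refine Submodule.sub_mem _ (Submodule.subset_span ⟨x, rfl, rfl⟩) ?_
    have : W H x.length ≤ (W H (s :: x).length).comap (L s) := by
      apply Submodule.span_le.2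
      rintro _ ⟨z, hz, rfl⟩
      exact Submodule.subset_span ⟨s :: z, by simp [hz], by simp⟩
    exact this ih

theorem Ph_l {H : Type} (a : ℕ) (x : T H) (y : List H) (hx : x ∈ W H a) :
    Ph (tm x (e y)) = -((-1 : ℤ) ^ a) • B x (e y)
      + ((-1 : ℤ) ^ (a * y.length + a)) • A x (e y) := by
  induction hx using Submodule.span_induction with
  | mem z h =>
    obtain ⟨x, rfl, rfl⟩ := h
    rw [Ph_e]
    simp only [add_mul, pow_add, pow_one, one_mul]
    have h2 : ((-1 : ℤ) ^ y.length) * (-1) ^ y.length = 1 := by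
      rw [← mul_pow]; simp
    module
  | zero => simp
  | add x z _ _ h1 h2 => 
    simp only [LinearMap.add_apply, map_add, h1, h2, LinearMap.add_apply]; module
  | smul r x _ h => 
    simp only [map_smul, map_smul, h, LinearMap.smul_apply]; module

theorem Ph_r {H : Type} (b : ℕ) (x : List H) (y : T H) (hy : y ∈ W H b) :
    Ph (tm (e x) y) = ((-1 : ℤ) ^ x.length) • B (e x) y
      + ((-1 : ℤ) ^ (x.length * b + b)) • A (e x) y := by
  induction hy using Submodule.span_induction with
  | mem z h =>
    obtain ⟨y, rfl, rfl⟩ := h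
    rw [Ph_e]
    have h2 : ((-1 : ℤ) ^ x.length) * (-1) ^ x.length = 1 := by
      rw [← mul_pow]; simp
    simp only [mul_add, pow_add, pow_one, mul_one]
    module
  | zero => simp
  | add x z _ _ h1 h2 => 
    simp only [map_sub, map_add, h1, h2]; module
  | smul r x _ h => 
    simp only [map_sub, map_smul, h]; module

theorem homot {H : Type} (x y : List H) :
    D (Ph (tm (e x) (e y))) + Ph (D (tm (e x) (e y))) =
      - ((-1 : ℤ) ^ (x.length * y.length + x.length + y.length)) • (tm (e y) (e x)) - tm (e x) (e y)
      + ((-1 : ℤ) ^ y.length) • (tm (e (x ++ y)) (e []))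
      + ((-1 : ℤ) ^ x.length) • (tm (e []) (e (x ++ y))) := by
  rw [Ph_e, D_t, map_sub, map_sub, Ph_l _ _ _ (d_mem x), sgn_e, map_smul tm, LinearMap.smul_apply,
    map_smul, map_smul, map_smul, Ph_r _ _ _ (d_mem y), D_A, D_B]
  simp only [mul_add, pow_add, mul_one, pow_mul]
  have h2 : ((-1 : ℤ) ^ x.length) * (-1) ^ x.length = 1 := by
    rw [← mul_pow]; simp
  have h3 : ((-1 : ℤ) ^ y.length) * (-1) ^ y.length = 1 := by
    rw [← mul_pow]; simp
  have h4 : (((-1 : ℤ) ^ x.length) ^ y.length) * ((-1) ^ x.length) ^ y.length = 1 := by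
    rw [← mul_pow, h2, one_pow]
  generalize ((-1 : ℤ) ^ x.length) ^ y.length = c at *
  generalize (-1 : ℤ) ^ x.length = a at *
  generalize (-1 : ℤ) ^ y.length = b at *
  simp only [smul_add, smul_sub, smul_smul]
  match_scalars <;> grind

/-- kill the empty word -/
def P {H : Type} : T H →ₗ[ℤ] T H := lft fun x => match x with
  | [] => 0
  | s :: x => e (s :: x)

theorem P_nil {H : Type} : P (e ([] : List H)) = 0 := by simp [P]

theorem P_cons {H : Type} (s : H) (x : List H) : P (e (s :: x)) = e (s :: x) := by simp [P]

theorem P_ne {H : Type} (x : List H) (h : x ≠ []) : P (e x) = e x := by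
  cases x with
  | nil => simp at h
  | cons => simp [P]

def PP {H : Type} : TT H →ₗ[ℤ] TT H := tmap P P

theorem Ph_PP {H : Type} (z : TT H) : Ph (PP z) = Ph z := by
  have : Ph ∘ₗ PP = Ph (H := H) := by
    apply hext2
    intro x y
    simp only [LinearMap.comp_apply, PP, tmap_t]
    rcases x with _ | ⟨s, x⟩
    · simp [P_nil, Ph_e, A_nil, B_nil]
    rcases y with _ | ⟨t, y⟩
    · simp [P_nil, Ph_e, A_eq_B]
    simp [P_cons]
  exact LinearMap.congr_fun this z

theorem d_sum {H : Type} (x : List H) :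
    d (e x) = ∑ i ∈ Finset.range x.length, ((-1 : ℤ) ^ i) • e (x.eraseIdx i) := by
  induction x with
  | nil => simp
  | cons s x ih =>
    rw [d_cons, List.length_cons, Finset.sum_range_succ', ih]
    simp [pow_succ, sub_eq_add_neg, add_comm]

theorem A_sum {H : Type} (x y : List H) :
    A (e x) (e y) = ∑ i ∈ Finset.range x.length,
      ((-1 : ℤ) ^ (y.length * i)) • (tm (e (x.take (i + 1) ++ y)) (e (x.drop i))) := by
  induction x with
  | nil => simp [A_nil]
  | cons s x ih =>
    rw [A_cons, List.length_cons, Finset.sum_range_succ', sgn_e, map_smul, ih]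
    simp only [map_sum, map_smul, L2_t, L_e, Finset.smul_sum, smul_smul]
    rw [add_comm]
    simp [pow_add, mul_add, mul_comm]

theorem B_sum {H : Type} (x y : List H) :
    B (e x) (e y) = ∑ i ∈ Finset.range x.length,
      (tm (e (x.take (i + 1))) (e (x.drop i ++ y))) := by
  induction x with
  | nil => simp [B_nil]
  | cons s x ih =>
    rw [B_cons, List.length_cons, Finset.sum_range_succ', ih]
    rw [add_comm]
    simp [conc_e]

end S11

namespace S11

def io (H : Type) : Bar2 H →ₗ[ℤ] TT H :=
  Finsupp.lmapDomain ℤ ℤ fun w => (List.ofFn w.2.2.1, List.ofFn w.2.2.2)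

theorem io_inj (H : Type) : Function.Injective (io H) := by
  apply Finsupp.mapDomain_injective
  rintro ⟨p, q, x, y⟩ ⟨p', q', x', y'⟩ h
  simp only [Prod.mk.injEq, List.ofFn_inj'] at h
  obtain ⟨h1, h2⟩ := h
  have e1 : p = p' := by simpa using congrArg Sigma.fst h1
  have e2 : q = q' := by simpa using congrArg Sigma.fst h2
  subst e1 e2
  simp at h1 h2
  subst h1 h2
  rfl

theorem io_cc {H : Type} [Group H] (p q : ℕ) (x : Tup H p) (y : Tup H q) :
    io H (cc H p q x y) = tm (e (List.ofFn x)) (e (List.ofFn y)) := by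
  simp [io, cc, tm_e]

theorem ofFn_face {H : Type} [Group H] (n : ℕ) (x : Tup H (n + 1)) (i : Fin (n + 2)) :
    List.ofFn (face H i x) = (List.ofFn x).eraseIdx i := by
  apply List.ext_getElem
  · simp [List.length_eraseIdx]; omega
  · intro k h1 h2
    simp only [List.getElem_ofFn, face, List.getElem_eraseIdx]
    split_ifs with h
    · congr 1
      apply Fin.ext
      simp [Fin.succAbove, Fin.lt_def, h]
    · congr 1
      apply Fin.ext
      simp [Fin.succAbove, Fin.lt_def, h]

theorem P_d_zero {H : Type} (x : Tup H 0) : P (d (e (List.ofFn x))) = 0 := by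
  simp [d_cons, P_nil]

theorem P_d_succ {H : Type} [Group H] (n : ℕ) (x : Tup H (n + 1)) :
    P (d (e (List.ofFn x))) =
      ∑ i : Fin (n + 2), ((-1 : ℤ) ^ (i : ℕ)) • e (List.ofFn (face H i x)) := by
  rw [d_sum]
  simp only [List.length_ofFn]
  rw [Finset.sum_range, map_sum]
  refine Finset.sum_congr rfl fun i _ => ?_
  rw [map_smul, ← ofFn_face, P_ne]
  simp

theorem P_ofFn {H : Type} (n : ℕ) (x : Tup H n) : P (e (List.ofFn x)) = e (List.ofFn x) := by
  rw [P_ne]; simp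

theorem PP_io {H : Type} [Group H] (z : Bar2 H) : PP (io H z) = io H z := by
  have : PP ∘ₗ io H = io H := by
    apply Finsupp.lhom_ext'
    rintro ⟨p, q, x, y⟩
    apply LinearMap.ext_ring
    change PP (io H (cc H p q x y)) = io H (cc H p q x y)
    rw [io_cc, PP, tmap_t, P_ofFn, P_ofFn]
  exact LinearMap.congr_fun this z

theorem io_bnd {H : Type} [Group H] (z : Bar2 H) : io H (bnd2 H z) = PP (D (io H z)) := by
  have : io H ∘ₗ bnd2 H = PP ∘ₗ D ∘ₗ io H := by
    apply Finsupp.lhom_ext'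
    rintro ⟨p, q, x, y⟩
    apply LinearMap.ext_ring
    change io H (bnd2 H (cc H p q x y)) = PP (D (io H (cc H p q x y)))
    rw [io_cc, D_t, sgn_e, map_sub, PP, tmap_t, tmap_t, map_smul, P_ofFn, P_ofFn]
    rw [bnd2, cc]
    simp only [Finsupp.lift_apply]
    rw [Finsupp.sum_single_index (by simp), one_smul]
    rcases p with _ | p <;> rcases q with _ | q <;>
      simp only [P_d_zero, P_d_succ, map_add, map_zero, map_sum, map_smul, LinearMap.zero_apply,
        LinearMap.smul_apply, LinearMap.sum_apply, List.length_ofFn, pow_succ, sub_eq_add_neg,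
        io_cc, mul_neg, mul_one, neg_smul, neg_neg, smul_zero, neg_zero, Finset.smul_sum,
        Finset.sum_neg_distrib, smul_neg, LinearMap.neg_apply, map_neg]
    all_goals simp only [smul_comm ((-1 : ℤ) ^ _) ((-1 : ℤ) ^ _)]
  exact LinearMap.congr_fun this z

theorem io_phi {H : Type} [Group H] (z : Bar2 H) : io H (phi2 H z) = Ph (io H z) := by
  have : io H ∘ₗ phi2 H = Ph ∘ₗ io H := by
    apply Finsupp.lhom_ext'
    rintro ⟨p, q, x, y⟩
    apply LinearMap.ext_ring
    change io H (phi2 H (cc H p q x y)) = Ph (io H (cc H p q x y))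
    rw [io_cc, Ph_e, A_sum, B_sum]
    simp only [List.length_ofFn]
    rw [Finset.sum_range, Finset.sum_range]
    rw [phi2, cc]
    simp only [Finsupp.lift_apply]
    rw [Finsupp.sum_single_index (by simp), one_smul]
    simp only [map_sub, map_smul, map_sum, io_cc]
    have h1 : (-1 : ℤ) ^ ((p + 1) * (q + 1) + (p + 1) + (q + 1)) = - (-1) ^ (p * q) := by
      rw [show (p + 1) * (q + 1) + (p + 1) + (q + 1) = p * q + 1 + 2 * (p + q + 1) by ring, pow_add,
        pow_mul]
      simp [pow_succ]
    rw [h1, pow_succ, sub_eq_add_neg, add_comm, sub_eq_add_neg, ← neg_smul, ← neg_smul, neg_neg,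
      mul_neg, mul_one]
    congr 2
    · refine Finset.sum_congr rfl fun i _ => ?_
      congr 2
      · congr 1
        apply List.ext_getElem
        · simp [-List.ofFn_succ]; omega
        · intro k h1 h2; simp [-List.ofFn_succ]
      · apply List.ext_getElem
        · simp [-List.ofFn_succ]; omega
        · intro k h1 h2
          simp [List.getElem_append, -List.ofFn_succ]
          split_ifs
          · rfl
          · omega
          · omega
          · congr 2
            omega
    · refine Finset.sum_congr rfl fun i _ => ?_
      congr 3
      · congr 1
        apply List.ext_getElem
        · simp [-List.ofFn_succ]; omega
        · intro k h1 h2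
          simp [List.getElem_append, -List.ofFn_succ]
          split_ifs
          · rfl
          · omega
          · omega
          · congr 2
            omega
      · apply List.ext_getElem
        · simp [-List.ofFn_succ]; omega
        · intro k h1 h2; simp [-List.ofFn_succ]
  exact LinearMap.congr_fun this z

end S11

/-- `φ` is a chain homotopy from the twist `τ` to the identity on `F ⊗ F`:
`τ − id = ∂φ + φ∂`. -/
theorem statement11 :
    tau2 G - LinearMap.id = bnd2 G ∘ₗ phi2 G + phi2 G ∘ₗ bnd2 G := by
  apply Finsupp.lhom_ext'
  rintro ⟨p, q, x, y⟩
  apply LinearMap.ext_ring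
  change tau2 G (cc G p q x y) - cc G p q x y =
    bnd2 G (phi2 G (cc G p q x y)) + phi2 G (bnd2 G (cc G p q x y))
  apply S11.io_inj
  have h1 : tau2 G (cc G p q x y) = ((-1 : ℤ) ^ (p * q)) • cc G q p y x := by
    rw [tau2, cc]
    simp only [Finsupp.lift_apply]
    rw [Finsupp.sum_single_index (by simp), one_smul]
  have h2 := congrArg S11.PP (S11.homot (List.ofFn x) (List.ofFn y))
  rw [map_add (S11.io G), ← S11.PP_io (phi2 G (bnd2 G (cc G p q x y))), S11.io_bnd, S11.io_phi,
    S11.io_phi, S11.io_bnd, S11.Ph_PP, S11.io_cc, ← map_add, h2, h1, map_sub, map_smul, S11.io_cc,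
    S11.io_cc]
  have h3 : (-1 : ℤ) ^ ((p + 1) * (q + 1) + (p + 1) + (q + 1)) = - (-1) ^ (p * q) := by
    rw [show (p + 1) * (q + 1) + (p + 1) + (q + 1) = p * q + 1 + 2 * (p + q + 1) by ring, pow_add,
      pow_mul]
    simp [pow_succ]
  simp only [S11.PP, map_add, map_sub, map_smul, S11.tmap_t, S11.P_ofFn, S11.P_nil, map_zero,
    LinearMap.zero_apply, smul_zero, add_zero, List.length_ofFn, h3, neg_neg]
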